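/- arXiv:2403.20292 — 2 statements merged into one kernel-verified Lean document; each statement's English description precedes it below -/
import Mathlib

section
/- For the MDP model E1 with initial state x0 = (0,0), the set of occupation measures D^Π_{x0} is compact in M(Y × A) with respect to the w-topology, but it is not compact with respect to the ws-topology. -/
open MeasureTheory ProbabilityTheory Filter Topology
open scoped ENNReal

noncomputable section

/-! ### General MDP framework

The state space of an absorbing-type MDP model is `X = Y ⊕ Unit`, where `Sum.inr ()` plays
the role of the isolated cemetery point `Δ` and `Y` is embedded via `Sum.inl`.

A history up to stage `n` is `h_n = (x_0, a_1, x_1, …, a_n, x_n)`, which we encode as the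
list of pairs `(x_k, a_{k+1})`, `k < n`, together with the last state `x_n`. -/

/-- The space `H_n` of histories up to stage `n`. -/
abbrev Hist (X A : Type*) (n : ℕ) : Type _ := (Fin n → X × A) × X

/-- A strategy: for every `n`, a stochastic (Markov) kernel on `A` given `H_n`,
prescribing the law of the action `a_{n+1}` given the history `h_n`. -/
def Strategy (X A : Type*) [MeasurableSpace X] [MeasurableSpace A] : Type _ :=
  {π : (n : ℕ) → Kernel (Hist X A n) A // ∀ n, IsMarkovKernel (π n)}

variable {X A Y : Type*} [MeasurableSpace X] [MeasurableSpace A] [MeasurableSpace Y]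

/-- The finite-dimensional distributions of the strategic measure `P^π_{x0}`:
`histLaw p π x0 n` is the joint law of `(X_0, A_1, …, A_n, X_n)` under `P^π_{x0}`,
built by the Ionescu-Tulcea recursion. -/
def histLaw (p : Kernel (X × A) X) (π : Strategy X A) (x0 : X) :
    (n : ℕ) → Measure (Hist X A n)
  | 0 => Measure.dirac (fun i => i.elim0, x0)
  | n + 1 =>
      (histLaw p π x0 n).bind fun h =>
        ((π.1 n) h).bind fun a =>
          (p (h.2, a)).map fun x' => (Fin.snoc h.1 (h.2, a), x')

/-- The law of the pair `(X_n, A_{n+1})` under the strategic measure `P^π_{x0}`. -/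
def pairLaw (p : Kernel (X × A) X) (π : Strategy X A) (x0 : X) (n : ℕ) :
    Measure (X × A) :=
  (histLaw p π x0 n).bind fun h => ((π.1 n) h).map fun a => (h.2, a)

/-- The occupation measure `η^π_{x0}` on `Y × A`:
`η^π_{x0}(dx × da) = Σ_n P^π_{x0}(X_n ∈ dx ∩ Y, A_{n+1} ∈ da)`. -/
def occupation (p : Kernel ((Y ⊕ Unit) × A) (Y ⊕ Unit)) (π : Strategy (Y ⊕ Unit) A)
    (x0 : Y ⊕ Unit) : Measure (Y × A) :=
  Measure.sum fun n => (pairLaw p π x0 n).comap fun ya : Y × A => (Sum.inl ya.1, ya.2)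

/-- `P^π_{x0}(X_t ∈ Y)`.  Since the cemetery `Δ` is absorbing, this equals the tail
probability `P^π_{x0}(τ > t)` of the hitting time `τ` of `Δ`. -/
def survive (p : Kernel ((Y ⊕ Unit) × A) (Y ⊕ Unit)) (π : Strategy (Y ⊕ Unit) A)
    (x0 : Y ⊕ Unit) (t : ℕ) : ℝ≥0∞ :=
  pairLaw p π x0 t {z | ∃ y : Y, z.1 = Sum.inl y}

/-- The model is absorbing with initial state `x0`:
`E^π_{x0}[τ] = Σ_t P^π_{x0}(τ > t) < ∞` for every strategy `π`. -/
def IsAbsorbing (p : Kernel ((Y ⊕ Unit) × A) (Y ⊕ Unit)) (x0 : Y ⊕ Unit) : Prop :=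
  ∀ π : Strategy (Y ⊕ Unit) A, ∑' t : ℕ, survive p π x0 t < ⊤

/-- The model is `Λ`-uniformly absorbing with initial state `x0`:
`sup_{π ∈ Λ} E^π_{x0}[Σ_{t=n}^∞ 1{τ > t}] = sup_{π ∈ Λ} Σ_{t ≥ n} P^π_{x0}(τ > t) → 0`. -/
def IsUnifAbsorbing (p : Kernel ((Y ⊕ Unit) × A) (Y ⊕ Unit))
    (Λ : Set (Strategy (Y ⊕ Unit) A)) (x0 : Y ⊕ Unit) : Prop :=
  Tendsto (fun n : ℕ => ⨆ π ∈ Λ, ∑' t : ℕ, survive p π x0 (n + t)) atTop (𝓝 0)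

/-- The set `D^Λ_{x0} ⊆ M(Y × A)` of occupation measures of strategies in `Λ`. -/
def OccSet (p : Kernel ((Y ⊕ Unit) × A) (Y ⊕ Unit)) (Λ : Set (Strategy (Y ⊕ Unit) A))
    (x0 : Y ⊕ Unit) : Set (FiniteMeasure (Y × A)) :=
  {η | ∃ π ∈ Λ, (η : Measure (Y × A)) = occupation p π x0}

/-- Condition (S): the action space is compact and `a ↦ ∫ g dp(·|x,a)` is continuous for
every bounded measurable `g` and every state `x`. -/
def ConditionS [TopologicalSpace A] (p : Kernel (X × A) X) : Prop :=
  CompactSpace A ∧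
    ∀ g : X → ℝ, Measurable g → (∃ C, ∀ x, |g x| ≤ C) →
      ∀ x : X, Continuous fun a : A => ∫ y, g y ∂(p (x, a))

/-- Condition (W): the action space is compact and `(x,a) ↦ ∫ g dp(·|x,a)` is continuous for
every bounded continuous `g`. -/
def ConditionW [TopologicalSpace X] [TopologicalSpace A] (p : Kernel (X × A) X) : Prop :=
  CompactSpace A ∧
    ∀ g : X → ℝ, Continuous g → (∃ C, ∀ x, |g x| ≤ C) →
      Continuous fun xa : X × A => ∫ y, g y ∂(p xa)

/-- The w-topology on `M(Ω)`: the coarsest topology making `η ↦ ∫ g dη` continuous for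
every bounded continuous `g : Ω → ℝ`. -/
def wTop (Ω : Type*) [TopologicalSpace Ω] [MeasurableSpace Ω] :
    TopologicalSpace (FiniteMeasure Ω) :=
  ⨅ (g : Ω → ℝ) (_ : Continuous g) (_ : ∃ C, ∀ z, |g z| ≤ C),
    TopologicalSpace.induced (fun η : FiniteMeasure Ω => ∫ z, g z ∂(η : Measure Ω))
      inferInstance

/-- The ws-topology on `M(Y × A)`: the coarsest topology making `η ↦ ∫ g dη` continuous for
every bounded Caratheodory function `g : Y × A → ℝ`. -/
def wsTop (Y A : Type*) [MeasurableSpace Y] [TopologicalSpace A] [MeasurableSpace A] :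
    TopologicalSpace (FiniteMeasure (Y × A)) :=
  ⨅ (g : Y × A → ℝ) (_ : Measurable g) (_ : ∃ C, ∀ z, |g z| ≤ C)
    (_ : ∀ y : Y, Continuous fun a : A => g (y, a)),
    TopologicalSpace.induced (fun η : FiniteMeasure (Y × A) => ∫ z, g z ∂(η : Measure (Y × A)))
      inferInstance

/-- The s-topology on `M(Y)`: the coarsest topology making `η ↦ ∫ f dη` continuous for
every bounded measurable `f : Y → ℝ`. -/
def sTop (Y : Type*) [MeasurableSpace Y] : TopologicalSpace (FiniteMeasure Y) :=
  ⨅ (f : Y → ℝ) (_ : Measurable f) (_ : ∃ C, ∀ z, |f z| ≤ C),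
    TopologicalSpace.induced (fun η : FiniteMeasure Y => ∫ z, f z ∂(η : Measure Y))
      inferInstance



/-! ### The MDP model E1 (Example 1 of the paper):
`Y = {0,1} × [0,1]` (`{0,1}` discrete — here `Bool` — and `[0,1]` Euclidean),
`A = [0,1]`, transitions `p({1} × dy | (0,x), a) = δ_a(dy)`, `p({Δ}|(1,x),a) = 1`,
`p({Δ}|Δ,a) = 1`, initial state `x₀ = (0,0)`. -/

/-- The space `Y = {0,1} × [0,1]` of the model E1. -/
abbrev Y1 : Type := Bool × ↥(Set.Icc (0:ℝ) 1)

/-- The action space `A = [0,1]` of the model E1. -/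
abbrev A1 : Type := ↥(Set.Icc (0:ℝ) 1)

/-- The state space `X = Y ∪ {Δ}` of the model E1. -/
abbrev X1 : Type := Y1 ⊕ Unit

/-- `0` as an element of `[0,1]`. -/
def c0 : ↥(Set.Icc (0:ℝ) 1) := ⟨0, ⟨le_rfl, zero_le_one⟩⟩

/-- The initial state `x₀ = (0,0)` of the model E1. -/
def x01 : X1 := Sum.inl (false, c0)

/-! ### Iterated integral formulas for the strategic measures -/

/-- The map appending an action and a state to a history. -/
def histAppend (n : ℕ) (z : (Hist X A n × A) × X) : Hist X A (n + 1) :=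
  (Fin.snoc z.1.1.1 (z.1.1.2, z.1.2), z.2)

lemma measurable_histAppend (n : ℕ) : Measurable (histAppend (X := X) (A := A) n) := by
  refine Measurable.prodMk ?_ measurable_snd
  refine measurable_pi_iff.2 fun i => ?_
  induction i using Fin.lastCases with
  | last => simp only [Fin.snoc_last]; fun_prop
  | cast i => simp only [Fin.snoc_castSucc]; fun_prop

lemma measurable_lastPair (n : ℕ) :
    Measurable fun z : Hist X A n × A => (z.1.2, z.2) := by fun_prop

/-- The law of the history at stage `n + 1` given the history and the action at stage `n`. -/
def histStep (p : Kernel (X × A) X) (n : ℕ) : Kernel (Hist X A n × A) (Hist X A (n + 1)) :=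
  (Kernel.id ×ₖ p.comap _ (measurable_lastPair n)).map (histAppend n)

instance (p : Kernel (X × A) X) [IsMarkovKernel p] (n : ℕ) : IsMarkovKernel (histStep p n) :=
  Kernel.IsMarkovKernel.map _ (measurable_histAppend n)

lemma histStep_apply (p : Kernel (X × A) X) [IsMarkovKernel p] (n : ℕ) (h : Hist X A n) (a : A) :
    histStep p n (h, a) = (p (h.2, a)).map fun x' => (Fin.snoc h.1 (h.2, a), x') := by
  rw [histStep, Kernel.map_apply _ (measurable_histAppend n), Kernel.prod_apply, Kernel.id_apply,
    Kernel.comap_apply, Measure.dirac_prod,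
    Measure.map_map (measurable_histAppend n) measurable_prodMk_left]
  rfl

instance (π : Strategy X A) (n : ℕ) : IsMarkovKernel (π.1 n) := π.2 n

lemma histLaw_succ (p : Kernel (X × A) X) [IsMarkovKernel p] (π : Strategy X A) (x0 : X) (n : ℕ) :
    histLaw p π x0 (n + 1) = (histLaw p π x0 n).bind (π.1 n ⊗ₖ histStep p n).snd := by
  rw [histLaw]
  congr 1
  funext h
  ext s hs
  have hm : Measurable fun a => histStep p n (h, a) :=
    (histStep p n).measurable.comp measurable_prodMk_left
  simp_rw [← histStep_apply]
  rw [Measure.bind_apply hs hm.aemeasurable, Kernel.snd_apply' _ _ hs,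
    Kernel.compProd_apply (measurable_snd hs)]
  rfl

lemma lintegral_histLaw_succ (p : Kernel (X × A) X) [IsMarkovKernel p] (π : Strategy X A) (x0 : X)
    (n : ℕ) {f : Hist X A (n + 1) → ℝ≥0∞} (hf : Measurable f) :
    ∫⁻ h, f h ∂histLaw p π x0 (n + 1) =
      ∫⁻ h, ∫⁻ a, ∫⁻ x', f (Fin.snoc h.1 (h.2, a), x') ∂p (h.2, a) ∂π.1 n h
        ∂histLaw p π x0 n := by
  rw [histLaw_succ, Measure.lintegral_bind (Kernel.aemeasurable _) hf.aemeasurable]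
  congr 1 with h
  rw [Kernel.lintegral_snd _ _ hf,
    Kernel.lintegral_compProd _ _ _ (f := fun z => f z.2) (hf.comp measurable_snd)]
  congr 1 with a
  rw [histStep_apply]
  exact lintegral_map hf ((measurable_histAppend n).comp (measurable_prodMk_left (x := (h, a))))

lemma lintegral_pairLaw (p : Kernel (X × A) X) (π : Strategy X A) (x0 : X)
    (n : ℕ) {f : X × A → ℝ≥0∞} (hf : Measurable f) :
    ∫⁻ z, f z ∂pairLaw p π x0 n = ∫⁻ h, ∫⁻ a, f (h.2, a) ∂π.1 n h ∂histLaw p π x0 n := by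
  have key : (fun h : Hist X A n => (π.1 n h).map fun a => (h.2, a)) =
      (Kernel.deterministic Prod.snd measurable_snd ×ₖ π.1 n) := by
    funext h
    rw [Kernel.prod_apply, Kernel.deterministic_apply, Measure.dirac_prod]
  rw [pairLaw, key, Measure.lintegral_bind (Kernel.aemeasurable _) hf.aemeasurable]
  congr 1 with h
  rw [← congrFun key h, lintegral_map hf measurable_prodMk_left]

lemma ae_histLaw_succ (p : Kernel (X × A) X) [IsMarkovKernel p] (π : Strategy X A) (x0 : X)
    (n : ℕ) {S : Set X} (hS : MeasurableSet S)
    (h : ∀ᵐ h ∂histLaw p π x0 n, ∀ a, p (h.2, a) Sᶜ = 0) :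
    ∀ᵐ h ∂histLaw p π x0 (n + 1), h.2 ∈ S := by
  have hm : MeasurableSet {h : Hist X A (n + 1) | h.2 ∉ S} := measurable_snd hS.compl
  rw [ae_iff, ← lintegral_indicator_one hm,
    lintegral_histLaw_succ p π x0 n (measurable_one.indicator hm)]
  refine (lintegral_congr_ae ?_).trans lintegral_zero
  filter_upwards [h] with h hh
  refine (lintegral_congr fun a => ?_).trans lintegral_zero
  rw [← hh a, ← lintegral_indicator_one hS.compl]
  rfl

/-! ### Occupation measures of the model E1 -/

/-- The occupation measure of a strategy under which the first two actions have joint law `ν`. -/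
def occOfJoint (ν : Measure (A1 × A1)) : Measure (Y1 × A1) :=
  ν.map (fun z => ((false, c0), z.1)) + ν.map (fun z => ((true, z.1), z.2))

/-- The history at stage `1` of the model E1 after action `a`. -/
def histOne (a : A1) : Hist X1 A1 1 := (Fin.snoc (fun i => i.elim0) (x01, a), Sum.inl (true, a))

lemma measurable_histOne : Measurable histOne :=
  (measurable_histAppend 0).comp
    (f := fun a : A1 => ((((fun i => i.elim0), x01), a), Sum.inl (true, a))) (by fun_prop)

/-- The joint law of the first two actions under a strategy in the model E1. -/
def jointLaw (π : Strategy X1 A1) : Measure (A1 × A1) :=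
  π.1 0 (fun i => i.elim0, x01) ⊗ₘ (π.1 1).comap histOne measurable_histOne

instance (π : Strategy X1 A1) : IsProbabilityMeasure (jointLaw π) := by
  unfold jointLaw; infer_instance

lemma measurableEmbedding_inl : MeasurableEmbedding (Sum.inl : X → X ⊕ Y) :=
  ⟨Sum.inl_injective, measurable_inl, fun _ hs => hs.inl_image⟩

lemma measurableSet_inl_false : MeasurableSet {z : X1 | ∃ x, z = Sum.inl (false, x)} := by
  convert (measurableEmbedding_inl (Y := Unit)).measurableSet_image.2
    (measurable_fst (measurableSet_singleton false) :
      MeasurableSet ((Prod.fst : Y1 → Bool) ⁻¹' {false})) using 1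
  ext z
  constructor
  · rintro ⟨x, rfl⟩
    exact ⟨(false, x), rfl, rfl⟩
  · rintro ⟨⟨_, x⟩, rfl, rfl⟩
    exact ⟨x, rfl⟩

instance [MeasurableSingletonClass X] [MeasurableSingletonClass Y] :
    MeasurableSingletonClass (X ⊕ Y) where
  measurableSet_singleton z := by
    rcases z with x | y
    · simpa using (measurableSet_singleton x).inl_image (β := Y)
    · simpa using (measurableSet_singleton y).inr_image (α := X)

lemma ae_cemetery (p : Kernel (X1 × A1) X1) [IsMarkovKernel p]
    (h0 : ∀ (x : ↥(Set.Icc (0:ℝ) 1)) (a : A1),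
      p (Sum.inl (false, x), a) = Measure.dirac (Sum.inl (true, a) : X1))
    (h1 : ∀ (x : ↥(Set.Icc (0:ℝ) 1)) (a : A1),
      p (Sum.inl (true, x), a) {(Sum.inr () : X1)} = 1)
    (hcem : ∀ a : A1, p ((Sum.inr () : X1), a) {(Sum.inr () : X1)} = 1)
    (π : Strategy X1 A1) (n : ℕ) :
    ∀ᵐ h ∂histLaw p π x01 (n + 2), h.2 = Sum.inr () := by
  have step : ∀ n, (∀ᵐ h ∂histLaw p π x01 n, h.2 ∈ {z : X1 | ∃ x, z = Sum.inl (false, x)}ᶜ) →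
      ∀ᵐ h ∂histLaw p π x01 (n + 1), h.2 ∈ ({Sum.inr ()} : Set X1) := by
    intro n hn
    refine ae_histLaw_succ p π x01 n (measurableSet_singleton _) ?_
    filter_upwards [hn] with h hh a
    rw [prob_compl_eq_zero_iff (measurableSet_singleton _)]
    rcases h with ⟨h, ⟨_ | _, x⟩ | ⟨⟩⟩
    · exact absurd ⟨x, rfl⟩ hh
    · exact h1 x a
    · exact hcem a
  induction n with
  | zero =>
    refine step 1 (ae_histLaw_succ p π x01 0 measurableSet_inl_false.compl ?_)
    rw [histLaw, ae_dirac_eq]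
    intro a
    rw [x01, h0, compl_compl, Measure.dirac_apply' _ measurableSet_inl_false]
    simp
  | succ n ih =>
    refine step (n + 2) (ih.mono fun h hh => ?_)
    simp [hh]

lemma occupation_eq (p : Kernel (X1 × A1) X1) [IsMarkovKernel p]
    (h0 : ∀ (x : ↥(Set.Icc (0:ℝ) 1)) (a : A1),
      p (Sum.inl (false, x), a) = Measure.dirac (Sum.inl (true, a) : X1))
    (h1 : ∀ (x : ↥(Set.Icc (0:ℝ) 1)) (a : A1),
      p (Sum.inl (true, x), a) {(Sum.inr () : X1)} = 1)
    (hcem : ∀ a : A1, p ((Sum.inr () : X1), a) {(Sum.inr () : X1)} = 1)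
    (π : Strategy X1 A1) :
    occupation p π x01 = occOfJoint (jointLaw π) := by
  have hι : MeasurableEmbedding fun ya : Y1 × A1 => ((Sum.inl ya.1 : X1), ya.2) :=
    measurableEmbedding_inl.prodMap .id
  ext s hs
  set f : X1 × A1 → ℝ≥0∞ :=
    ((fun ya : Y1 × A1 => ((Sum.inl ya.1 : X1), ya.2)) '' s).indicator 1 with hf_def
  have hm := hι.measurableSet_image.2 hs
  have hf : Measurable f := measurable_one.indicator hm
  have hf_inl : ∀ y a, f (Sum.inl y, a) = s.indicator 1 (y, a) := fun y a =>
    Set.indicator_image (g := fun ya : Y1 × A1 => ((Sum.inl ya.1 : X1), ya.2)) (f := 1)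
      hι.injective (x := (y, a))
  have hf_inr : ∀ a, f (Sum.inr (), a) = 0 := fun a => by
    simp [hf_def]
  have happ : ∀ n, (pairLaw p π x01 n).comap (fun ya : Y1 × A1 => ((Sum.inl ya.1 : X1), ya.2)) s =
      ∫⁻ h, ∫⁻ a, f (h.2, a) ∂π.1 n h ∂histLaw p π x01 n := by
    intro n
    rw [hι.comap_apply, ← lintegral_indicator_one hm, lintegral_pairLaw _ _ _ _ hf]
  have hf_meas : ∀ n, Measurable fun h : Hist X1 A1 n => ∫⁻ a, f (h.2, a) ∂π.1 n h := fun n =>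
    Measurable.lintegral_kernel_prod_right' (κ := π.1 n)
      (f := fun z : Hist X1 A1 n × A1 => f (z.1.2, z.2)) (hf.comp (measurable_lastPair n))
  have happ_zero : ∫⁻ h, ∫⁻ a, f (h.2, a) ∂π.1 0 h ∂histLaw p π x01 0 =
      (jointLaw π).map (fun z => (((false, c0) : Y1), z.1)) s := by
    have hg : Measurable fun a : A1 => (((false, c0) : Y1), a) := by fun_prop
    rw [histLaw, lintegral_dirac' _ (hf_meas 0),
      show (fun z : A1 × A1 => (((false, c0) : Y1), z.1)) = (fun a => ((false, c0), a)) ∘ Prod.fst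
        from rfl, ← Measure.map_map hg measurable_fst, ← Measure.fst, jointLaw,
      Measure.fst_compProd, ← lintegral_indicator_one hs,
      lintegral_map (measurable_one.indicator hs) hg]
    exact lintegral_congr fun a => hf_inl _ a
  have happ_one : ∫⁻ h, ∫⁻ a, f (h.2, a) ∂π.1 1 h ∂histLaw p π x01 1 =
      (jointLaw π).map (fun z => (((true, z.1) : Y1), z.2)) s := by
    have hg : Measurable fun z : A1 × A1 => (((true, z.1) : Y1), z.2) := by fun_prop
    have hi : Measurable (s.indicator (1 : Y1 × A1 → ℝ≥0∞)) := measurable_one.indicator hs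
    rw [lintegral_histLaw_succ _ _ _ _ (hf_meas 1), histLaw, lintegral_dirac,
      ← lintegral_indicator_one hs, lintegral_map hi hg, jointLaw,
      Measure.lintegral_compProd (f := fun z => s.indicator 1 ((true, z.1), z.2)) (hi.comp hg)]
    refine lintegral_congr fun a => ?_
    rw [x01, h0, lintegral_dirac]
    exact lintegral_congr fun b => hf_inl _ b
  have happ_tail : ∀ n, ∫⁻ h, ∫⁻ a, f (h.2, a) ∂π.1 (n + 2) h ∂histLaw p π x01 (n + 2) = 0 := by
    intro n
    refine (lintegral_congr_ae ?_).trans lintegral_zero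
    filter_upwards [ae_cemetery p h0 h1 hcem π n] with h hh
    simp [hh, hf_inr]
  rw [occupation, Measure.sum_apply _ hs, tsum_eq_sum (s := Finset.range 2), Finset.sum_range_succ,
    Finset.sum_range_one, happ, happ, happ_zero, happ_one, occOfJoint, Measure.add_apply]
  intro n hn
  obtain ⟨m, rfl⟩ := Nat.exists_eq_add_of_le' (show 2 ≤ n by simpa [Nat.succ_le_iff] using hn)
  rw [happ, happ_tail]

/-- A strategy in the model E1 under which the first two actions have joint law `ν`. -/
def strategyOfJoint (ν : Measure (A1 × A1)) [IsProbabilityMeasure ν] : Strategy X1 A1 :=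
  ⟨fun n => match n with
    | 0 => Kernel.const _ ν.fst
    | 1 => ν.condKernel.comap (fun h => (h.1 0).2) (by fun_prop)
    | _ + 2 => Kernel.const _ (Measure.dirac c0),
  fun n => match n with
    | 0 => by dsimp only; infer_instance
    | 1 => by dsimp only; infer_instance
    | _ + 2 => by dsimp only; infer_instance⟩

lemma jointLaw_strategyOfJoint (ν : Measure (A1 × A1)) [IsProbabilityMeasure ν] :
    jointLaw (strategyOfJoint ν) = ν := by
  conv_rhs => rw [← ν.disintegrate ν.condKernel]
  rfl

/-- The occupation measure `occOfJoint ν` as a finite measure. -/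
def finiteOccOfJoint (ν : ProbabilityMeasure (A1 × A1)) : FiniteMeasure (Y1 × A1) :=
  ⟨occOfJoint ν, by unfold occOfJoint; infer_instance⟩

lemma occSet_eq_range (p : Kernel (X1 × A1) X1) [IsMarkovKernel p]
    (h0 : ∀ (x : ↥(Set.Icc (0:ℝ) 1)) (a : A1),
      p (Sum.inl (false, x), a) = Measure.dirac (Sum.inl (true, a) : X1))
    (h1 : ∀ (x : ↥(Set.Icc (0:ℝ) 1)) (a : A1),
      p (Sum.inl (true, x), a) {(Sum.inr () : X1)} = 1)
    (hcem : ∀ a : A1, p ((Sum.inr () : X1), a) {(Sum.inr () : X1)} = 1) :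
    OccSet p Set.univ x01 = Set.range finiteOccOfJoint := by
  ext η
  constructor
  · rintro ⟨π, -, hη⟩
    exact ⟨⟨jointLaw π, inferInstance⟩,
      Subtype.ext ((occupation_eq p h0 h1 hcem π).symm.trans hη.symm)⟩
  · rintro ⟨ν, rfl⟩
    refine ⟨strategyOfJoint ν, trivial, ?_⟩
    rw [occupation_eq p h0 h1 hcem, jointLaw_strategyOfJoint]
    rfl

lemma continuous_finiteOccOfJoint :
    Continuous[inferInstance, wTop (Y1 × A1)] finiteOccOfJoint := by
  refine continuous_iInf_rng.2 fun g => continuous_iInf_rng.2 fun hg =>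
    continuous_iInf_rng.2 fun ⟨C, hC⟩ => continuous_induced_rng.2 ?_
  let g' : C(A1 × A1, ℝ) :=
    ⟨fun z => g ((false, c0), z.1) + g ((true, z.1), z.2), by fun_prop⟩
  refine (ProbabilityMeasure.continuous_integral_continuousMap g').congr fun ν => ?_
  have hint : ∀ μ : Measure (Y1 × A1), IsFiniteMeasure μ → Integrable g μ := fun μ _ =>
    .of_bound hg.aestronglyMeasurable C (ae_of_all _ hC)
  have hm₁ : Measurable fun z : A1 × A1 => (((false, c0) : Y1), z.1) := by fun_prop
  have hm₂ : Measurable fun z : A1 × A1 => (((true, z.1) : Y1), z.2) := by fun_prop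
  change ∫ z, g _ + g _ ∂(ν : Measure (A1 × A1)) = ∫ z, g z ∂occOfJoint ν
  rw [occOfJoint, integral_add_measure (hint _ inferInstance) (hint _ inferInstance),
    integral_map hm₁.aemeasurable hg.aestronglyMeasurable,
    integral_map hm₂.aemeasurable hg.aestronglyMeasurable, integral_add]
  · exact (integrable_map_measure hg.aestronglyMeasurable hm₁.aemeasurable).1
      (hint _ inferInstance)
  · exact (integrable_map_measure hg.aestronglyMeasurable hm₂.aemeasurable).1
      (hint _ inferInstance)

/-! ### Failure of compactness in the ws-topology -/

lemma IsCompact.exists_forall_eq_of_eventually_eq {Z : Type*} [TopologicalSpace Z] {s : Set Z}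
    (hs : IsCompact s) {u : ℕ → Z} (hu : ∀ n, u n ∈ s) :
    ∃ z, ∀ F : Z → ℝ, Continuous F → ∀ c, (∀ᶠ n in atTop, F (u n) = c) → F z = c := by
  obtain ⟨z, -, hz⟩ := hs.exists_mapClusterPt (f := atTop) (u := u)
    (le_principal_iff.2 (mem_map.2 (Eventually.of_forall hu)))
  refine ⟨z, fun F hF c hc => ?_⟩
  have hcl : MapClusterPt (F z) atTop (F ∘ u) := hz.continuousAt_comp hF.continuousAt
  by_contra hne
  obtain ⟨n, hn, hn_eq⟩ := ((hcl.frequently (isOpen_ne.mem_nhds hne)).and_eventually hc).exists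
  exact hn hn_eq

/-- The cylinder over `{1} × S`, for `S ⊆ [0,1]`. -/
def secondStage (S : Set A1) : Set (Y1 × A1) := {z | z.1.1 = true ∧ z.1.2 ∈ S}

lemma measurableSet_secondStage {S : Set A1} (hS : MeasurableSet S) :
    MeasurableSet (secondStage S) :=
  ((measurable_fst.comp measurable_fst) (measurableSet_singleton true)).inter
    ((measurable_snd.comp measurable_fst) hS)

lemma continuous_real_secondStage {S : Set A1} (hS : MeasurableSet S) :
    Continuous[wsTop Y1 A1, inferInstance]
      fun η : FiniteMeasure (Y1 × A1) => (η : Measure (Y1 × A1)).real (secondStage S) := by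
  have hm := measurableSet_secondStage hS
  simp_rw [← integral_indicator_one hm]
  refine continuous_iInf_dom (i := (secondStage S).indicator 1) <|
    continuous_iInf_dom (i := measurable_one.indicator hm) <|
    continuous_iInf_dom (i := ⟨1, fun z => ?_⟩) <|
    continuous_iInf_dom (i := fun y => ?_) continuous_induced_dom
  · by_cases hz : z ∈ secondStage S <;> simp [hz]
  · exact continuous_const (y := {x | y.1 = true ∧ y.2 ∈ S}.indicator (1 : A1 → ℝ) c0)

lemma occOfJoint_dirac_secondStage {S : Set A1} (hS : MeasurableSet S) (x a : A1) :
    (occOfJoint (Measure.dirac (x, a))).real (secondStage S) = S.indicator 1 x := by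
  have hm := measurableSet_secondStage hS
  rw [occOfJoint, Measure.map_dirac' (by fun_prop), Measure.map_dirac' (by fun_prop),
    Measure.real, Measure.add_apply, Measure.dirac_apply' _ hm, Measure.dirac_apply' _ hm]
  by_cases hx : x ∈ S <;> simp [secondStage, hx]

lemma not_isCompact_range_finiteOccOfJoint :
    ¬ @IsCompact _ (wsTop Y1 A1) (Set.range finiteOccOfJoint) := by
  intro hc
  let u : ℕ → A1 := fun n =>
    ⟨((n : ℝ) + 1)⁻¹, by positivity, inv_le_one_of_one_le₀ (by linarith [n.cast_nonneg (α := ℝ)])⟩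
  have hu : Function.Injective u := fun m n h => by
    simpa [u] using congrArg Subtype.val h
  obtain ⟨η, hη⟩ := @IsCompact.exists_forall_eq_of_eventually_eq _ (wsTop Y1 A1) _ hc
    (fun n => finiteOccOfJoint ⟨Measure.dirac (u n, c0), inferInstance⟩) fun n => ⟨_, rfl⟩
  have hone : (η : Measure (Y1 × A1)).real (secondStage (Set.range u)) = 1 := by
    have hS : MeasurableSet (Set.range u) := (Set.countable_range u).measurableSet
    refine hη _ (continuous_real_secondStage hS) 1 (Eventually.of_forall fun n => ?_)
    exact (occOfJoint_dirac_secondStage hS _ _).trans (by simp)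
  have hzero : ∀ k, (η : Measure (Y1 × A1)).real (secondStage {u k}) = 0 := fun k => by
    have hS : MeasurableSet {u k} := measurableSet_singleton _
    refine hη _ (continuous_real_secondStage hS) 0 ?_
    filter_upwards [eventually_gt_atTop k] with n hn
    exact (occOfJoint_dirac_secondStage hS _ _).trans (by simp [hu.eq_iff, hn.ne'])
  have hunion : secondStage (Set.range u) = ⋃ k, secondStage {u k} := by
    ext z
    simp only [secondStage, Set.mem_iUnion, Set.mem_ofPred_eq, Set.mem_singleton_iff, Set.mem_range]
    grind
  have hnull : (η : Measure (Y1 × A1)) (secondStage (Set.range u)) = 0 := by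
    rw [hunion, measure_iUnion_null_iff]
    exact fun k => (measureReal_eq_zero_iff).1 (hzero k)
  simp [Measure.real, hnull] at hone

/-- Proposition 2(d) of the paper.  For the model E1 with initial state
`x₀ = (0,0)`, the set `D^Π_{x₀}` of occupation measures is w-compact in `M(Y × A)` but not
ws-compact. -/
theorem stmt11
    (p : Kernel (X1 × A1) X1) [IsMarkovKernel p]
    (h0 : ∀ (x : ↥(Set.Icc (0:ℝ) 1)) (a : A1),
      p (Sum.inl (false, x), a) = Measure.dirac (Sum.inl (true, a) : X1))
    (h1 : ∀ (x : ↥(Set.Icc (0:ℝ) 1)) (a : A1),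
      p (Sum.inl (true, x), a) {(Sum.inr () : X1)} = 1)
    (hcem : ∀ a : A1, p ((Sum.inr () : X1), a) {(Sum.inr () : X1)} = 1) :
    @IsCompact _ (wTop (Y1 × A1)) (OccSet p Set.univ x01) ∧
      ¬ @IsCompact _ (wsTop Y1 A1) (OccSet p Set.univ x01) := by
  rw [occSet_eq_range p h0 h1 hcem]
  exact ⟨@isCompact_range _ _ _ (wTop (Y1 × A1)) _ _ continuous_finiteOccOfJoint,
    not_isCompact_range_finiteOccOfJoint⟩

end
end

section
/- For the MDP model E2 with initial state x0 = b_1 = 1/2, the marginals on Y of the occupation measures of the strategies ψ^n and ψ are as follows. For each n ≥ 3: η^{ψ^n}_{1/2}|_Y({b_m}) = 2^{1−m} for 1 ≤ m ≤ n, η^{ψ^n}_{1/2}|_Y({b_{n+1}}) = 1/2, η^{ψ^n}_{1/2}|_Y({b_m}) = 0 for m > n+1, and η^{ψ^n}_{1/2}|_Y({1}) = 0. Moreover, η^{ψ}_{1/2}|_Y({b_m}) = 2^{1−m} for all m ≥ 1 and η^{ψ}_{1/2}|_Y({1}) = 1/2. -/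
open MeasureTheory ProbabilityTheory Filter Topology
open scoped ENNReal

noncomputable section

variable {X A Y : Type*} [MeasurableSpace X] [MeasurableSpace A] [MeasurableSpace Y]

/-! ### The MDP model E2 (Example 2 of the paper):
`Y = {b_n : n ≥ 1} ∪ {1} ⊆ ℝ` with `b_n = Σ_{i=1}^n 2^{-i} = 1 - 2^{-n}` (relative Euclidean
topology), `A = {1,2,3}` discrete (here `Fin 3`, with `0 ↔ 1`, `1 ↔ 2`, `2 ↔ 3`). -/

/-- `b n = 1 - 2^{-n}`; the points of `Y` are `b n` for `n ≥ 1`, together with `1`. -/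
def b2 : ℕ → ℝ := fun n => 1 - (1/2) ^ n

/-- The set `Y = {b_n : n ≥ 1} ∪ {1} ⊆ ℝ`. -/
def SY2 : Set ℝ := {x : ℝ | ∃ k : ℕ, x = b2 (k + 1)} ∪ {1}

/-- The space `Y` of the model E2, with the relative Euclidean topology. -/
abbrev Y2 : Type := ↥SY2

/-- The point `b_{k+1} ∈ Y` (so `bY 0 = b_1 = 1/2`). -/
def bY (k : ℕ) : Y2 := ⟨b2 (k + 1), Or.inl ⟨k, rfl⟩⟩

/-- The point `1 ∈ Y`. -/
def oneY : Y2 := ⟨1, Or.inr rfl⟩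

/-- The action space `A = {1,2,3}` of the model E2 (as `Fin 3`: `0 ↔ 1`, `1 ↔ 2`, `2 ↔ 3`). -/
abbrev A2 : Type := Fin 3

/-- The state space `X = Y ∪ {Δ}` of the model E2. -/
abbrev X2 : Type := Y2 ⊕ Unit

/-- The initial state `x₀ = b_1 = 1/2`. -/
def x02 : X2 := Sum.inl (bY 0)

/-- `π` is the deterministic stationary strategy given by the map `ψ`:
at every stage the action is `ψ(x)` where `x` is the current state. -/
def IsStationaryWith {X A : Type*} [MeasurableSpace X] [MeasurableSpace A]
    (π : Strategy X A) (ψ : X → A) : Prop :=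
  ∀ n, ∀ h : Hist X A n, (π.1 n) h = Measure.dirac (ψ h.2)

open scoped Classical in
/-- The map of the deterministic stationary strategy `ψ^n` (paper indexing, `n ≥ 3`):
action `2` on `{b_1, …, b_n}`, action `1` on `{b_m : m ≥ n+1}`, action `3` on `{1, Δ}`. -/
def psiN (n : ℕ) : X2 → A2 := fun x =>
  match x with
  | Sum.inr _ => 2
  | Sum.inl y =>
      if (y : ℝ) = 1 then 2 else if ∃ k, k < n ∧ (y : ℝ) = b2 (k + 1) then 1 else 0

/-- The map of the deterministic stationary strategy `ψ ≡ 3`. -/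
def psiInf : X2 → A2 := fun _ => 2

/-- `Λ = {ψ^n : n ≥ 3} ∪ {ψ}`. -/
def Lambda2 : Set (Strategy X2 A2) :=
  {π | ∃ n, 3 ≤ n ∧ IsStationaryWith π (psiN n)} ∪ {π | IsStationaryWith π psiInf}

section E2Kernel

variable (p : Kernel (X2 × A2) X2)

/-- The transition kernel of the model E2 (the action `a = 1` at `b_1` leads to `Δ`;
at `b_n`, `n ≥ 2`, it stays with probability `1 - 2^{2-n}` and moves to `Δ` with probability
`2^{2-n}`; `a = 2` moves to `b_{n+1}` or `Δ` with probability `1/2` each; `a = 3` moves to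
`b_{n+1}` with probability `1/2` and to `1` or `Δ` with probability `1/4` each; `1` and `Δ`
lead to `Δ`).  In the indexing below, `bY k` is the paper's `b_{k+1}`, and for `n = k+1 ≥ 2`
one has `2^{2-n} = (1/2)^{k-1}`. -/
def IsE2Kernel : Prop :=
  (∀ a : A2, p ((Sum.inr () : X2), a) {(Sum.inr () : X2)} = 1) ∧
  (∀ a : A2, p (Sum.inl oneY, a) {(Sum.inr () : X2)} = 1) ∧
  (p (Sum.inl (bY 0), (0 : A2)) {(Sum.inr () : X2)} = 1) ∧
  (∀ k : ℕ, 1 ≤ k →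
    p (Sum.inl (bY k), (0 : A2)) {(Sum.inl (bY k) : X2)} = 1 - (1/2 : ℝ≥0∞) ^ (k - 1) ∧
    p (Sum.inl (bY k), (0 : A2)) {(Sum.inr () : X2)} = (1/2 : ℝ≥0∞) ^ (k - 1)) ∧
  (∀ k : ℕ,
    p (Sum.inl (bY k), (1 : A2)) {(Sum.inr () : X2)} = 1/2 ∧
    p (Sum.inl (bY k), (1 : A2)) {(Sum.inl (bY (k + 1)) : X2)} = 1/2) ∧
  (∀ k : ℕ,
    p (Sum.inl (bY k), (2 : A2)) {(Sum.inr () : X2)} = 1/4 ∧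
    p (Sum.inl (bY k), (2 : A2)) {(Sum.inl oneY : X2)} = 1/4 ∧
    p (Sum.inl (bY k), (2 : A2)) {(Sum.inl (bY (k + 1)) : X2)} = 1/2)

end E2Kernel

/-- The probability that the chain driven by the kernel `p` and the stationary map `ψ`, started
at `x0`, is in a given state at time `n`. -/
def stateProb {X A : Type*} [MeasurableSpace X] [MeasurableSpace A] (p : Kernel (X × A) X)
    (ψ : X → A) (x0 : X) : ℕ → X → ℝ≥0∞
  | 0, x => Measure.dirac x0 {x}
  | n + 1, x => ∑' y, stateProb p ψ x0 n y * p (y, ψ y) {x}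

/-- The expected number of visits to a given state. -/
def visits {X A : Type*} [MeasurableSpace X] [MeasurableSpace A] (p : Kernel (X × A) X)
    (ψ : X → A) (x0 x : X) : ℝ≥0∞ :=
  ∑' n, stateProb p ψ x0 n x

/-- The sum of two spaces with measurable singletons has measurable singletons. -/
instance {α β : Type*} [MeasurableSpace α] [MeasurableSpace β] [MeasurableSingletonClass α]
    [MeasurableSingletonClass β] : MeasurableSingletonClass (α ⊕ β) where
  measurableSet_singleton := by
    rintro (a | b)
    · rw [← Set.image_singleton]
      exact (measurableSet_singleton a).inl_image
    · rw [← Set.image_singleton]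
      exact (measurableSet_singleton b).inr_image

theorem histLaw_snd_preimage {X A : Type*} [MeasurableSpace X] [MeasurableSpace A]
    [Countable X] [MeasurableSingletonClass X] [Countable A] [MeasurableSingletonClass A]
    (p : Kernel (X × A) X) {π : Strategy X A} {ψ : X → A} (hπ : IsStationaryWith π ψ) (x0 : X)
    (n : ℕ) (x : X) :
    histLaw p π x0 n (Prod.snd ⁻¹' {x}) = stateProb p ψ x0 n x := by
  induction n generalizing x with
  | zero =>
    rw [histLaw, stateProb, Measure.dirac_apply' _ (.of_discrete),
      Measure.dirac_apply' _ (.of_discrete)]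
    rfl
  | succ n ih =>
    have hstep (h : Hist X A n) :
        (((π.1 n) h).bind fun a => (p (h.2, a)).map fun x' =>
          ((Fin.snoc h.1 (h.2, a) : Fin (n + 1) → X × A), x')) (Prod.snd ⁻¹' {x}) =
          p (h.2, ψ h.2) {x} := by
      rw [hπ n h, Measure.dirac_bind (.of_discrete),
        Measure.map_apply (.of_discrete) (.of_discrete)]
      rfl
    have hmap : ∫⁻ h, p (h.2, ψ h.2) {x} ∂(histLaw p π x0 n) =
        ∫⁻ y, p (y, ψ y) {x} ∂((histLaw p π x0 n).map Prod.snd) :=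
      (lintegral_map (f := fun y => p (y, ψ y) {x}) (.of_discrete) measurable_snd).symm
    rw [histLaw, Measure.bind_apply (.of_discrete) Measurable.of_discrete.aemeasurable,
      lintegral_congr hstep, hmap, lintegral_countable', stateProb]
    refine tsum_congr fun y => ?_
    rw [Measure.map_apply measurable_snd (.of_discrete), ih, mul_comm]

theorem occupation_map_fst_singleton {Y A : Type*} [MeasurableSpace Y] [MeasurableSpace A]
    [Countable Y] [MeasurableSingletonClass Y] [Countable A] [MeasurableSingletonClass A]
    (p : Kernel ((Y ⊕ Unit) × A) (Y ⊕ Unit)) {π : Strategy (Y ⊕ Unit) A} {ψ : Y ⊕ Unit → A}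
    (hπ : IsStationaryWith π ψ) (x0 : Y ⊕ Unit) (y : Y) :
    ((occupation p π x0).map Prod.fst) {y} = visits p ψ x0 (Sum.inl y) := by
  have hinj : Function.Injective fun ya : Y × A => ((Sum.inl ya.1 : Y ⊕ Unit), ya.2) := by
    rintro ⟨y, a⟩ ⟨z, b⟩ h
    simpa using h
  have himg : (fun ya : Y × A => ((Sum.inl ya.1 : Y ⊕ Unit), ya.2)) '' (Prod.fst ⁻¹' {y}) =
      Prod.fst ⁻¹' {Sum.inl y} := by
    ext ⟨z, a⟩
    simp [eq_comm]
  rw [Measure.map_apply measurable_fst (.of_discrete), occupation,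
    Measure.sum_apply _ (.of_discrete), visits]
  refine tsum_congr fun n => ?_
  rw [Measure.comap_apply _ hinj (fun _ _ => .of_discrete) _ (.of_discrete), himg, pairLaw,
    Measure.bind_apply (.of_discrete) Measurable.of_discrete.aemeasurable,
    ← histLaw_snd_preimage p hπ, ← lintegral_indicator_one (.of_discrete)]
  refine lintegral_congr fun h => ?_
  rw [hπ n h, Measure.map_apply (.of_discrete) (.of_discrete),
    Measure.dirac_apply' _ (.of_discrete)]
  rfl

theorem visits_eq {X A : Type*} [MeasurableSpace X] [MeasurableSpace A] (p : Kernel (X × A) X)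
    (ψ : X → A) (x0 x : X) :
    visits p ψ x0 x =
      Measure.dirac x0 {x} + ∑' y, visits p ψ x0 y * p (y, ψ y) {x} := by
  rw [visits, tsum_eq_zero_add' ENNReal.summable]
  simp only [visits, ← ENNReal.tsum_mul_right]
  rw [ENNReal.tsum_comm]
  rfl

/-- The expected number of visits is the smallest solution of the balance equation. -/
theorem visits_le {X A : Type*} [MeasurableSpace X] [MeasurableSpace A] (p : Kernel (X × A) X)
    (ψ : X → A) (x0 : X) (v : X → ℝ≥0∞)
    (hv : ∀ x, Measure.dirac x0 {x} + ∑' y, v y * p (y, ψ y) {x} ≤ v x) (x : X) :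
    visits p ψ x0 x ≤ v x := by
  have hpart (N : ℕ) : ∀ x, ∑ n ∈ Finset.range N, stateProb p ψ x0 n x ≤ v x := by
    induction N with
    | zero => simp
    | succ N ih =>
      intro x
      refine le_trans ?_ (hv x)
      rw [Finset.sum_range_succ', add_comm]
      simp only [stateProb]
      rw [← Summable.tsum_finsetSum fun _ _ => ENNReal.summable]
      gcongr with y
      rw [← Finset.sum_mul]
      gcongr
      exact ih y
  rw [visits, ENNReal.tsum_eq_iSup_nat]
  exact iSup_le fun N => hpart N x

theorem measure_singleton_eq_zero_of_sum_eq_one {X : Type*} [MeasurableSpace X]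
    [MeasurableSingletonClass X] (μ : Measure X) [IsProbabilityMeasure μ] (s : Finset X)
    (hs : ∑ x ∈ s, μ {x} = 1) {c : X} (hc : c ∉ s) : μ {c} = 0 := by
  rw [sum_measure_singleton] at hs
  refine measure_mono_null (t := (s : Set X)ᶜ) (by simpa using hc) ?_
  rwa [prob_compl_eq_zero_iff s.measurableSet]

theorem b2_lt_one (k : ℕ) : b2 k < 1 := by
  simp [b2]

theorem b2_injective : Function.Injective b2 := by
  intro j k h
  simpa [b2] using h

theorem bY_injective : Function.Injective bY := fun _ _ h =>
  Nat.succ_injective (b2_injective (congrArg Subtype.val h))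

theorem bY_ne_oneY (k : ℕ) : bY k ≠ oneY := fun h =>
  (b2_lt_one (k + 1)).ne (congrArg Subtype.val h)

theorem eq_bY_or_eq_oneY (y : Y2) : (∃ k, y = bY k) ∨ y = oneY := by
  obtain ⟨y, ⟨k, rfl⟩ | rfl⟩ := y
  · exact Or.inl ⟨k, rfl⟩
  · exact Or.inr rfl

/-- The points of `Y` are `b_1, b_2, …` and `1`. -/
def optionNatEquivY2 : Option ℕ ≃ Y2 :=
  Equiv.ofBijective (fun o : Option ℕ => o.elim oneY bY) <| by
    constructor
    · intro i j h
      rcases i with _ | i <;> rcases j with _ | j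
      · rfl
      · exact (bY_ne_oneY j h.symm).elim
      · exact (bY_ne_oneY i h).elim
      · exact congrArg some (bY_injective h)
    · intro y
      obtain ⟨k, rfl⟩ | rfl := eq_bY_or_eq_oneY y
      · exact ⟨some k, rfl⟩
      · exact ⟨none, rfl⟩

instance : Countable Y2 := optionNatEquivY2.symm.injective.countable

theorem tsum_X2 (f : X2 → ℝ≥0∞) :
    ∑' x, f x = f (Sum.inr ()) + f (Sum.inl oneY) + ∑' k, f (Sum.inl (bY k)) := by
  rw [Summable.tsum_sum ENNReal.summable ENNReal.summable, ← optionNatEquivY2.tsum_eq,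
    ← (Equiv.optionEquivSumPUnit.{0, 0} ℕ).symm.tsum_eq,
    Summable.tsum_sum ENNReal.summable ENNReal.summable]
  simp only [optionNatEquivY2, Equiv.optionEquivSumPUnit_symm_inl, tsum_fintype,
    Equiv.optionEquivSumPUnit_symm_inr, Finset.univ_unique, Finset.sum_singleton]
  rw [add_comm, add_comm (∑' _, _), ← add_assoc]
  rfl

theorem psiN_bY_of_lt {n k : ℕ} (h : k < n) : psiN n (Sum.inl (bY k)) = 1 := by
  have h1 : ((bY k : Y2) : ℝ) ≠ 1 := (b2_lt_one (k + 1)).ne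
  rw [psiN, if_neg h1, if_pos ⟨k, h, rfl⟩]

theorem psiN_bY_of_le {n k : ℕ} (h : n ≤ k) : psiN n (Sum.inl (bY k)) = 0 := by
  have h1 : ((bY k : Y2) : ℝ) ≠ 1 := (b2_lt_one (k + 1)).ne
  rw [psiN, if_neg h1, if_neg]
  rintro ⟨j, hj, h2⟩
  have := b2_injective h2
  omega

section E2

variable {p : Kernel (X2 × A2) X2} [IsMarkovKernel p]

theorem IsE2Kernel.apply_inr (hp : IsE2Kernel p) (a : A2) (y : Y2) :
    p (Sum.inr (), a) {Sum.inl y} = 0 :=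
  measure_singleton_eq_zero_of_sum_eq_one _ {Sum.inr ()} (by simpa using hp.1 a) (by simp)

theorem IsE2Kernel.apply_oneY (hp : IsE2Kernel p) (a : A2) (y : Y2) :
    p (Sum.inl oneY, a) {Sum.inl y} = 0 :=
  measure_singleton_eq_zero_of_sum_eq_one _ {Sum.inr ()} (by simpa using hp.2.1 a) (by simp)

theorem IsE2Kernel.apply_zero (hp : IsE2Kernel p) {k : ℕ} (hk : 1 ≤ k) {y : Y2}
    (hy : y ≠ bY k) : p (Sum.inl (bY k), 0) {Sum.inl y} = 0 := by
  refine measure_singleton_eq_zero_of_sum_eq_one _ {Sum.inl (bY k), Sum.inr ()} ?_ (by simp [hy])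
  obtain ⟨h1, h2⟩ := hp.2.2.2.1 k hk
  rw [Finset.sum_pair (by simp), h1, h2]
  exact tsub_add_cancel_of_le (pow_le_one₀ zero_le (by simp))

theorem IsE2Kernel.apply_one (hp : IsE2Kernel p) {k : ℕ} {y : Y2}
    (hy : y ≠ bY (k + 1)) : p (Sum.inl (bY k), 1) {Sum.inl y} = 0 := by
  refine measure_singleton_eq_zero_of_sum_eq_one _ {Sum.inr (), Sum.inl (bY (k + 1))} ?_
    (by simp [hy])
  obtain ⟨h1, h2⟩ := hp.2.2.2.2.1 k
  rw [Finset.sum_pair (by simp), h1, h2, ENNReal.add_halves]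

theorem IsE2Kernel.apply_two (hp : IsE2Kernel p) {k : ℕ} {y : Y2}
    (hy : y ≠ bY (k + 1)) (hy' : y ≠ oneY) : p (Sum.inl (bY k), 2) {Sum.inl y} = 0 := by
  refine measure_singleton_eq_zero_of_sum_eq_one _
    {Sum.inr (), Sum.inl oneY, Sum.inl (bY (k + 1))} ?_ (by simp [hy, hy'])
  obtain ⟨h1, h2, h3⟩ := hp.2.2.2.2.2 k
  rw [Finset.sum_insert (by simp), Finset.sum_pair (by simpa using (bY_ne_oneY _).symm), h1, h2, h3]
  rw [← ENNReal.toReal_eq_one_iff]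
  rw [ENNReal.toReal_add (by finiteness) (by finiteness),
    ENNReal.toReal_add (by finiteness) (by finiteness)]
  norm_num

/-- Flow into a point of `Y`: only the states `b_k` contribute. -/
theorem IsE2Kernel.tsum_mul_apply (hp : IsE2Kernel p) (ψ : X2 → A2) (v : X2 → ℝ≥0∞) (y : Y2) :
    ∑' x, v x * p (x, ψ x) {Sum.inl y} =
      ∑' k, v (Sum.inl (bY k)) * p (Sum.inl (bY k), ψ (Sum.inl (bY k))) {Sum.inl y} := by
  rw [tsum_X2, hp.apply_inr, hp.apply_oneY]
  simp

theorem dirac_x02_bY_zero : Measure.dirac x02 {Sum.inl (bY 0)} = 1 := by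
  simp [x02]

theorem dirac_x02_bY_succ (k : ℕ) : Measure.dirac x02 {Sum.inl (bY (k + 1))} = 0 := by
  simp [x02, bY_injective.eq_iff]

theorem dirac_x02_oneY : Measure.dirac x02 {Sum.inl oneY} = 0 := by
  simp [x02, bY_ne_oneY]

theorem IsE2Kernel.visits_psiInf_bY (hp : IsE2Kernel p) (k : ℕ) :
    visits p psiInf x02 (Sum.inl (bY k)) = (1/2 : ℝ≥0∞) ^ k := by
  induction k with
  | zero =>
    rw [visits_eq, hp.tsum_mul_apply, dirac_x02_bY_zero]
    simp [psiInf, hp.apply_two, bY_injective.eq_iff, bY_ne_oneY]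
  | succ k ih =>
    rw [visits_eq, hp.tsum_mul_apply, dirac_x02_bY_succ, tsum_eq_single k, ih, pow_succ, psiInf,
      (hp.2.2.2.2.2 k).2.2, zero_add]
    intro j hj
    rw [psiInf, hp.apply_two (by simpa [bY_injective.eq_iff] using hj.symm) (bY_ne_oneY _),
      mul_zero]

theorem IsE2Kernel.visits_psiInf_oneY (hp : IsE2Kernel p) :
    visits p psiInf x02 (Sum.inl oneY) = 1/2 := by
  rw [visits_eq, hp.tsum_mul_apply, dirac_x02_oneY, zero_add]
  simp only [hp.visits_psiInf_bY]
  simp only [psiInf, (hp.2.2.2.2.2 _).2.1]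
  rw [ENNReal.tsum_mul_right, ENNReal.tsum_geometric, one_div, ENNReal.one_sub_inv_two,
    inv_inv, ← ENNReal.toReal_eq_toReal_iff' (by finiteness) (by finiteness), ENNReal.toReal_mul]
  norm_num

/-- Flow into `b_1` under `ψ^n`. -/
theorem IsE2Kernel.tsum_mul_apply_psiN_zero (hp : IsE2Kernel p) {n : ℕ} (hn : 0 < n)
    (v : X2 → ℝ≥0∞) :
    ∑' x, v x * p (x, psiN n x) {Sum.inl (bY 0)} = 0 := by
  rw [hp.tsum_mul_apply, ENNReal.tsum_eq_zero]
  intro j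
  rcases lt_or_ge j n with h | h
  · rw [psiN_bY_of_lt h, hp.apply_one (bY_injective.ne (by omega)), mul_zero]
  · rw [psiN_bY_of_le h, hp.apply_zero (by omega) (bY_injective.ne (by omega)), mul_zero]

/-- Flow into `b_{k+2}` under `ψ^n`. -/
theorem IsE2Kernel.tsum_mul_apply_psiN_succ (hp : IsE2Kernel p) {n : ℕ} (hn : 0 < n)
    (v : X2 → ℝ≥0∞) (k : ℕ) :
    ∑' x, v x * p (x, psiN n x) {Sum.inl (bY (k + 1))} =
      (if k < n then v (Sum.inl (bY k)) * (1/2) else 0) +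
      (if n ≤ k + 1 then v (Sum.inl (bY (k + 1))) * (1 - (1/2) ^ k) else 0) := by
  have hsupp (j : ℕ) (hj : j ∉ ({k, k + 1} : Finset ℕ)) : v (Sum.inl (bY j)) *
      p (Sum.inl (bY j), psiN n (Sum.inl (bY j))) {Sum.inl (bY (k + 1))} = 0 := by
    simp only [Finset.mem_insert, Finset.mem_singleton, not_or] at hj
    rcases lt_or_ge j n with h | h
    · rw [psiN_bY_of_lt h, hp.apply_one (bY_injective.ne (by omega)), mul_zero]
    · rw [psiN_bY_of_le h, hp.apply_zero (by omega) (bY_injective.ne (by omega)), mul_zero]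
  rw [hp.tsum_mul_apply, tsum_eq_sum hsupp, Finset.sum_pair (by simp)]
  congr 1
  · split_ifs with h
    · rw [psiN_bY_of_lt h, (hp.2.2.2.2.1 k).2]
    · rw [psiN_bY_of_le (by omega), hp.apply_zero (by omega) (bY_injective.ne (by omega)),
        mul_zero]
  · split_ifs with h
    · rw [psiN_bY_of_le h, (hp.2.2.2.1 (k + 1) (by omega)).1, Nat.add_sub_cancel]
    · rw [psiN_bY_of_lt (by omega), hp.apply_one (bY_injective.ne (by omega)), mul_zero]

theorem IsE2Kernel.tsum_mul_apply_psiN_oneY (hp : IsE2Kernel p) {n : ℕ} (hn : 0 < n)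
    (v : X2 → ℝ≥0∞) :
    ∑' x, v x * p (x, psiN n x) {Sum.inl oneY} = 0 := by
  rw [hp.tsum_mul_apply, ENNReal.tsum_eq_zero]
  intro j
  rcases lt_or_ge j n with h | h
  · rw [psiN_bY_of_lt h, hp.apply_one (bY_ne_oneY _).symm, mul_zero]
  · rw [psiN_bY_of_le h, hp.apply_zero (by omega) (bY_ne_oneY _).symm, mul_zero]

theorem IsE2Kernel.visits_psiN_bY_of_lt (hp : IsE2Kernel p) {n k : ℕ} (hk : k < n) :
    visits p (psiN n) x02 (Sum.inl (bY k)) = (1/2 : ℝ≥0∞) ^ k := by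
  induction k with
  | zero => rw [visits_eq, hp.tsum_mul_apply_psiN_zero hk, dirac_x02_bY_zero, add_zero, pow_zero]
  | succ k ih =>
    rw [visits_eq, hp.tsum_mul_apply_psiN_succ (by omega), dirac_x02_bY_succ, if_pos (by omega),
      if_neg (by omega), ih (by omega), pow_succ, zero_add, add_zero]

theorem IsE2Kernel.visits_psiN_oneY (hp : IsE2Kernel p) {n : ℕ} (hn : 0 < n) :
    visits p (psiN n) x02 (Sum.inl oneY) = 0 := by
  rw [visits_eq, hp.tsum_mul_apply_psiN_oneY hn, dirac_x02_oneY, add_zero]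

/-- An upper bound for the expected numbers of visits under `ψ^n` to the points `b_k`. -/
theorem IsE2Kernel.visits_psiN_bY_le (hp : IsE2Kernel p) {n : ℕ} (hn : 0 < n) (k : ℕ) :
    visits p (psiN n) x02 (Sum.inl (bY k)) ≤
      if k < n then (1/2) ^ k else if k = n then 1/2 else 0 := by
  let w : ℕ → ℝ≥0∞ := fun k => if k < n then (1/2) ^ k else if k = n then 1/2 else 0
  let v : X2 → ℝ≥0∞ :=
    Sum.elim (fun y => (optionNatEquivY2.symm y).elim 0 w) (fun _ => ⊤)
  have hv_bY (j : ℕ) : v (Sum.inl (bY j)) = w j :=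
    congrArg (fun o : Option ℕ => o.elim 0 w) (optionNatEquivY2.symm_apply_apply (some j))
  refine (visits_le p (psiN n) x02 v ?_ (Sum.inl (bY k))).trans_eq (hv_bY k)
  rintro (y | _)
  · obtain ⟨j, rfl⟩ | rfl := eq_bY_or_eq_oneY y
    · rcases j with _ | j
      · rw [hp.tsum_mul_apply_psiN_zero hn, dirac_x02_bY_zero, hv_bY]
        simp [w, hn]
      · rw [hp.tsum_mul_apply_psiN_succ hn, dirac_x02_bY_succ, hv_bY, hv_bY, zero_add]
        rcases lt_trichotomy (j + 1) n with h | rfl | h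
        · simp [w, h, show j < n by omega, show ¬ n ≤ j + 1 by omega, pow_succ]
        · have hle : (1/2 : ℝ≥0∞) ^ j ≤ 1 := pow_le_one₀ zero_le (by simp)
          simp only [w, lt_add_one, lt_irrefl, le_refl, if_true, if_false]
          rw [mul_comm, ← mul_add, add_tsub_cancel_of_le hle, mul_one]
        · simp [w, show ¬ j < n by omega, show ¬ j + 1 < n by omega, show j + 1 ≠ n by omega]
    · rw [hp.tsum_mul_apply_psiN_oneY hn, dirac_x02_oneY, add_zero]
      exact zero_le
  · exact le_top

theorem IsE2Kernel.visits_psiN_bY_of_gt (hp : IsE2Kernel p) {n k : ℕ} (hn : 0 < n)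
    (hk : n < k) : visits p (psiN n) x02 (Sum.inl (bY k)) = 0 := by
  simpa [hk.not_gt, hk.ne'] using hp.visits_psiN_bY_le hn k

theorem IsE2Kernel.visits_psiN_bY_self (hp : IsE2Kernel p) {n : ℕ} (hn : 0 < n) :
    visits p (psiN n) x02 (Sum.inl (bY n)) = 1/2 := by
  obtain ⟨m, rfl⟩ := Nat.exists_eq_add_one.mpr hn
  have hle := hp.visits_psiN_bY_le hn (m + 1)
  have heq := visits_eq p (psiN (m + 1)) x02 (Sum.inl (bY (m + 1)))
  rw [hp.tsum_mul_apply_psiN_succ hn, dirac_x02_bY_succ, if_pos (by omega), if_pos le_rfl,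
    hp.visits_psiN_bY_of_lt (lt_add_one m), zero_add] at heq
  rw [if_neg (by omega), if_pos rfl] at hle
  generalize visits p (psiN (m + 1)) x02 (Sum.inl (bY (m + 1))) = η at hle heq
  have hη : η ≠ ⊤ := ne_top_of_le_ne_top (by finiteness) hle
  have hq : (1/2 : ℝ≥0∞) ^ m ≤ 1 := pow_le_one₀ zero_le (by simp)
  have hreal := congrArg ENNReal.toReal heq
  rw [ENNReal.toReal_add (by finiteness) (by finiteness), ENNReal.toReal_mul, ENNReal.toReal_mul,
    ENNReal.toReal_sub_of_le hq (by simp), ENNReal.toReal_pow] at hreal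
  rw [← ENNReal.toReal_eq_toReal_iff' hη (by finiteness)]
  refine mul_left_cancel₀ (a := (1/2 : ℝ≥0∞).toReal ^ m) (by simp) ?_
  rw [ENNReal.toReal_one] at hreal
  linarith

end E2

/-- For the model E2 with initial state `x₀ = b_1 = 1/2`, the marginals on
`Y` of the occupation measures of `ψ^n` (`n ≥ 3`) and `ψ` are:
`η^{ψ^n}|_Y({b_m}) = 2^{1-m}` for `1 ≤ m ≤ n` (below, `m = k+1`, `2^{1-m} = (1/2)^k`),
`η^{ψ^n}|_Y({b_{n+1}}) = 1/2`, `η^{ψ^n}|_Y({b_m}) = 0` for `m > n+1`, `η^{ψ^n}|_Y({1}) = 0`;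
`η^{ψ}|_Y({b_m}) = 2^{1-m}` for all `m ≥ 1`, and `η^{ψ}|_Y({1}) = 1/2`. -/
theorem stmt13
    (p : Kernel (X2 × A2) X2) [IsMarkovKernel p] (hp : IsE2Kernel p) :
    (∀ n : ℕ, 3 ≤ n → ∀ π : Strategy X2 A2, IsStationaryWith π (psiN n) →
      (∀ k : ℕ, k < n →
        ((occupation p π x02).map Prod.fst) {bY k} = (1/2 : ℝ≥0∞) ^ k) ∧
      ((occupation p π x02).map Prod.fst) {bY n} = 1/2 ∧
      (∀ k : ℕ, n + 1 ≤ k →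
        ((occupation p π x02).map Prod.fst) {bY k} = 0) ∧
      ((occupation p π x02).map Prod.fst) {oneY} = 0) ∧
    ∀ π : Strategy X2 A2, IsStationaryWith π psiInf →
      (∀ k : ℕ, ((occupation p π x02).map Prod.fst) {bY k} = (1/2 : ℝ≥0∞) ^ k) ∧
      ((occupation p π x02).map Prod.fst) {oneY} = 1/2 := by
  refine ⟨fun n hn π hπ => ⟨fun k hk => ?_, ?_, fun k hk => ?_, ?_⟩, fun π hπ =>
    ⟨fun k => ?_, ?_⟩⟩ <;> rw [occupation_map_fst_singleton p hπ]
  · exact hp.visits_psiN_bY_of_lt hk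
  · exact hp.visits_psiN_bY_self (by omega)
  · exact hp.visits_psiN_bY_of_gt (by omega) hk
  · exact hp.visits_psiN_oneY (by omega)
  · exact hp.visits_psiInf_bY k
  · exact hp.visits_psiInf_oneY

end
end
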